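/- arXiv:math/0205021 — 5 statements merged into one kernel-verified Lean document; each statement's English description precedes it below -/
import Mathlib

section
/- Let R be a commutative ring, let f, g ∈ R[X] be monic polynomials, let A = R[X]/(f·g), and let M be a free A-module. Then multiplication by f induces an isomorphism of A-modules M/gM ≅ ker(g· : M → M); in particular, the kernel of multiplication by g on M equals the submodule f·M. -/
open Polynomial

/-- If the annihilator of `a` in `A` is the ideal generated by `b`, then the same holds on every
free `A`-module. -/
theorem ker_lsmul_eq_range_lsmul_of_free {A : Type*} [CommRing A] {a b : A}
    (h : ∀ x : A, a * x = 0 ↔ b ∣ x) (M : Type*) [AddCommGroup M] [Module A M] [Module.Free A M] :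
    LinearMap.ker (LinearMap.lsmul A M a) = LinearMap.range (LinearMap.lsmul A M b) := by
  ext m
  simp only [LinearMap.mem_ker, LinearMap.mem_range, LinearMap.lsmul_apply]
  constructor
  · intro hm
    let B := Module.Free.chooseBasis A M
    have hB : ∀ i, b ∣ B.repr m i := fun i => (h _).1 <| by
      simpa using DFunLike.congr_fun (congrArg B.repr hm) i
    choose c hc using hB
    refine ⟨∑ i ∈ (B.repr m).support, c i • B i, ?_⟩
    conv_rhs => rw [← B.linearCombination_repr m, Finsupp.linearCombination_apply, Finsupp.sum]
    rw [Finset.smul_sum]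
    refine Finset.sum_congr rfl fun i _ => ?_
    rw [smul_smul, ← hc]
  · rintro ⟨n, rfl⟩
    rw [smul_smul, (h b).2 dvd_rfl, zero_smul]

/-- In `R[X]/(f * g)` with `g` monic, the annihilator of `g` is generated by `f`. -/
theorem mk_mul_eq_zero_iff_mk_dvd {R : Type*} [CommRing R] (f : R[X]) {g : R[X]} (hg : g.Monic)
    (x : R[X] ⧸ Ideal.span {f * g}) :
    Ideal.Quotient.mk (Ideal.span {f * g}) g * x = 0 ↔
      Ideal.Quotient.mk (Ideal.span {f * g}) f ∣ x := by
  constructor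
  · obtain ⟨p, rfl⟩ := Ideal.Quotient.mk_surjective x
    rw [← map_mul, Ideal.Quotient.eq_zero_iff_mem, Ideal.mem_span_singleton, mul_comm f g]
    rintro ⟨q, hq⟩
    rw [mul_assoc] at hq
    rw [hg.isRegular.left hq]
    exact map_dvd _ (dvd_mul_right f q)
  · rintro ⟨y, rfl⟩
    rw [← mul_assoc, ← map_mul, mul_comm g f,
      Ideal.Quotient.eq_zero_iff_mem.2 (Ideal.mem_span_singleton_self _), zero_mul]

/-- Let `f, g` be monic polynomials over a commutative ring `R`, let
`A = R[X]/(f·g)`, and let `M` be a free `A`-module. Then multiplication by `f` induces an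
`A`-module isomorphism `M/gM ≅ ker(g· : M → M)`; in particular the kernel of
multiplication by `g` equals the submodule `f·M`. -/
theorem quotient_iso_ker_of_free (R : Type*) [CommRing R] (f g : R[X])
    (hf : f.Monic) (hg : g.Monic)
    (M : Type*) [AddCommGroup M] [Module (R[X] ⧸ Ideal.span {f * g}) M]
    [Module.Free (R[X] ⧸ Ideal.span {f * g}) M] :
    (∃ e : (M ⧸ LinearMap.range (LinearMap.lsmul (R[X] ⧸ Ideal.span {f * g}) M
          (Ideal.Quotient.mk (Ideal.span {f * g}) g))) ≃ₗ[R[X] ⧸ Ideal.span {f * g}]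
        LinearMap.ker (LinearMap.lsmul (R[X] ⧸ Ideal.span {f * g}) M
          (Ideal.Quotient.mk (Ideal.span {f * g}) g)),
      ∀ m : M, (e (Submodule.Quotient.mk m) : M) =
        (Ideal.Quotient.mk (Ideal.span {f * g}) f) • m) ∧
    LinearMap.ker (LinearMap.lsmul (R[X] ⧸ Ideal.span {f * g}) M
        (Ideal.Quotient.mk (Ideal.span {f * g}) g)) =
      LinearMap.range (LinearMap.lsmul (R[X] ⧸ Ideal.span {f * g}) M
        (Ideal.Quotient.mk (Ideal.span {f * g}) f)) := by
  have hker_g := ker_lsmul_eq_range_lsmul_of_free (mk_mul_eq_zero_iff_mk_dvd f hg) M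
  have hker_f : LinearMap.ker (LinearMap.lsmul (R[X] ⧸ Ideal.span {f * g}) M
        (Ideal.Quotient.mk (Ideal.span {f * g}) f)) =
      LinearMap.range (LinearMap.lsmul (R[X] ⧸ Ideal.span {f * g}) M
        (Ideal.Quotient.mk (Ideal.span {f * g}) g)) := by
    refine ker_lsmul_eq_range_lsmul_of_free ?_ M
    rw [mul_comm f g]
    exact mk_mul_eq_zero_iff_mk_dvd g hf
  exact ⟨⟨(Submodule.quotEquivOfEq _ _ hker_f.symm).trans
    ((LinearMap.quotKerEquivRange _).trans (LinearEquiv.ofEq _ _ hker_g.symm)),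
    fun _ => rfl⟩, hker_g⟩
end

section
/- Let R be a commutative ring, let a ∈ R, let h ∈ R[X] be monic, and set g = (X − a)·h. Let M be a free module over B = R[X]/(g). Then the assignment m ↦ h·m induces an isomorphism of R-modules M/(X − a)M ≅ ker((X − a)· : M → M). -/
open Polynomial

/-- If the annihilator of `x` in `B` consists of multiples of `y`, then on a free `B`-module every
vector killed by `x` is a multiple of `y`. -/
theorem exists_smul_eq_of_smul_eq_zero {B M : Type*} [CommRing B] [AddCommGroup M] [Module B M]
    [Module.Free B M] {x y : B} (hxy : ∀ b, x * b = 0 → y ∣ b) {m : M} (hm : x • m = 0) :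
    ∃ n : M, y • n = m := by
  let v := Module.Free.chooseBasis B M
  have hdvd : ∀ i, y ∣ v.repr m i := fun i => hxy _ <| by
    simpa using congrArg (fun n => v.repr n i) hm
  choose c hc using hdvd
  refine ⟨∑ i ∈ (v.repr m).support, c i • v i, ?_⟩
  conv_rhs => rw [← v.linearCombination_repr m, Finsupp.linearCombination_apply, Finsupp.sum]
  simp only [Finset.smul_sum, smul_smul, ← hc]

/-- In `R[X] ⧸ (g)` with `g = p * q` and `p` monic, the annihilator of `p` is generated by `q`. -/
theorem mk_dvd_of_mk_mul_eq_zero {R : Type*} [CommRing R] {p q g : R[X]} (hp : p.Monic)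
    (hg : g = p * q) (b : R[X] ⧸ Ideal.span {g})
    (hb : Ideal.Quotient.mk (Ideal.span {g}) p * b = 0) :
    Ideal.Quotient.mk (Ideal.span {g}) q ∣ b := by
  obtain ⟨b, rfl⟩ := Ideal.Quotient.mk_surjective b
  rw [← map_mul, Ideal.Quotient.eq_zero_iff_mem, Ideal.mem_span_singleton, hg] at hb
  obtain ⟨c, hc⟩ := hb
  rw [mul_assoc] at hc
  exact map_dvd _ ⟨c, hp.isRegular.left hc⟩

/-- If `x * y = 0` and `x`, `y` are exact on `M`, then multiplication by `y` induces an isomorphism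
from the cokernel of `x` to the kernel of `x`. -/
theorem exists_quotient_range_lsmul_equiv_ker (R : Type*) {B M : Type*} [CommRing R] [CommRing B]
    [Algebra R B] [AddCommGroup M] [Module B M] [Module R M] [IsScalarTower R B M] {x y : B}
    (hxy : x * y = 0) (hx : ∀ m : M, x • m = 0 → ∃ n : M, y • n = m)
    (hy : ∀ m : M, y • m = 0 → ∃ n : M, x • n = m) :
    ∃ e : (M ⧸ LinearMap.range ((LinearMap.lsmul B M x).restrictScalars R)) ≃ₗ[R]
        LinearMap.ker ((LinearMap.lsmul B M x).restrictScalars R),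
      ∀ m : M, (e (Submodule.Quotient.mk m) : M) = y • m := by
  let f : M →ₗ[R] LinearMap.ker ((LinearMap.lsmul B M x).restrictScalars R) :=
    ((LinearMap.lsmul B M y).restrictScalars R).codRestrict _ fun m => by
      change x • y • m = 0
      rw [smul_smul, hxy, zero_smul]
  have hf : Function.Surjective f := fun ⟨m, hm⟩ => by
    obtain ⟨n, hn⟩ := hx m (by simpa using hm)
    exact ⟨n, Subtype.ext hn⟩
  have hker : LinearMap.range ((LinearMap.lsmul B M x).restrictScalars R) = LinearMap.ker f := by
    ext m
    rw [LinearMap.mem_ker, Subtype.ext_iff]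
    constructor
    · rintro ⟨n, rfl⟩
      change y • x • n = 0
      rw [smul_smul, mul_comm, hxy, zero_smul]
    · exact fun hm => hy m hm
  exact ⟨(Submodule.quotEquivOfEq _ _ hker).trans (f.quotKerEquivOfSurjective hf), fun m => rfl⟩

/-- Let `a ∈ R`, let `h ∈ R[X]` be monic, set `g = (X − a)·h` and
`B = R[X]/(g)`, and let `M` be a free `B`-module. Then `m ↦ h·m` induces an isomorphism of
`R`-modules `M/(X − a)M ≅ ker((X − a)· : M → M)`. -/
theorem quotient_iso_ker_linear_factor (R : Type*) [CommRing R] (a : R) (h : R[X])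
    (hh : h.Monic)
    (M : Type*) [AddCommGroup M]
    [Module (R[X] ⧸ Ideal.span {(X - C a) * h}) M]
    [Module R M] [IsScalarTower R (R[X] ⧸ Ideal.span {(X - C a) * h}) M]
    [Module.Free (R[X] ⧸ Ideal.span {(X - C a) * h}) M] :
    ∃ e : (M ⧸ LinearMap.range ((LinearMap.lsmul (R[X] ⧸ Ideal.span {(X - C a) * h}) M
          (Ideal.Quotient.mk (Ideal.span {(X - C a) * h}) (X - C a))).restrictScalars R))
        ≃ₗ[R]
        LinearMap.ker ((LinearMap.lsmul (R[X] ⧸ Ideal.span {(X - C a) * h}) M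
          (Ideal.Quotient.mk (Ideal.span {(X - C a) * h}) (X - C a))).restrictScalars R),
      ∀ m : M, (e (Submodule.Quotient.mk m) : M) =
        (Ideal.Quotient.mk (Ideal.span {(X - C a) * h}) h) • m := by
  refine exists_quotient_range_lsmul_equiv_ker R ?_
    (fun m => exists_smul_eq_of_smul_eq_zero (mk_dvd_of_mk_mul_eq_zero (monic_X_sub_C a) rfl))
    (fun m => exists_smul_eq_of_smul_eq_zero (mk_dvd_of_mk_mul_eq_zero hh (mul_comm _ _)))
  rw [← map_mul, Ideal.Quotient.eq_zero_iff_mem]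
  exact Ideal.mem_span_singleton_self _
end

section
/- Let S be a commutative ring, e ≥ 1, and a_1, …, a_e ∈ S such that a_i − a_j is a unit of S whenever i ≠ j. Let A = S[X]/(∏_{j=1}^e (X − a_j)) and let F be an A-module. Then F is the internal direct sum of the submodules F_i = ker((X − a_i)· : F → F) for i = 1, …, e, and there is exactly one chain of S-submodules 0 = F^0 ⊆ F^1 ⊆ ⋯ ⊆ F^e = F satisfying (X − a_j)·F^j ⊆ F^{j−1} for all j = 1, …, e, namely F^j = F_1 + F_2 + ⋯ + F_j. -/
open Polynomial

namespace Polynomial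

variable {S F ι : Type*} [CommRing S] [AddCommGroup F] [Module S F]

theorem ker_aeval_prod_eq_iSup (T : Module.End S F) (p : ι → S[X])
    (hp : Pairwise fun i j => IsCoprime (p i) (p j)) (s : Finset ι) :
    LinearMap.ker (aeval T (∏ i ∈ s, p i)) = ⨆ i ∈ s, LinearMap.ker (aeval T (p i)) := by
  classical
  induction s using Finset.induction_on with
  | empty => simp [Module.End.one_eq_id]
  | insert i s hi ih =>
    rw [Finset.prod_insert hi, Finset.iSup_insert, ← ih, sup_ker_aeval_eq_ker_aeval_mul_of_coprime]
    exact IsCoprime.prod_right fun j hj => hp fun h => hi (h ▸ hj)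

theorem iSupIndep_ker_aeval [Fintype ι] (T : Module.End S F) (p : ι → S[X])
    (hp : Pairwise fun i j => IsCoprime (p i) (p j)) :
    iSupIndep fun i => LinearMap.ker (aeval T (p i)) := by
  classical
  intro i
  have h := ker_aeval_prod_eq_iSup T p hp (Finset.univ.erase i)
  simp only [Finset.mem_erase, Finset.mem_univ, and_true] at h
  rw [← h]
  refine disjoint_ker_aeval_of_isCoprime T (IsCoprime.prod_right fun j hj => hp ?_)
  exact (Finset.ne_of_mem_erase hj).symm

end Polynomial

namespace Module.End

variable {S F : Type*} [CommRing S] [AddCommGroup F] [Module S F] {e : ℕ}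

theorem aeval_X_sub_C_apply (T : Module.End S F) (a : S) (x : F) :
    aeval T (X - C a) x = T x - a • x := by
  simp [Module.algebraMap_end_apply]

theorem aeval_prod_apply_eq_zero_of_chain (T : Module.End S F) (p : Fin e → S[X])
    (G : Fin (e + 1) → Submodule S F) (h0 : G 0 = ⊥)
    (hG : ∀ j : Fin e, ∀ x ∈ G j.succ, aeval T (p j) x ∈ G j.castSucc) (j : Fin (e + 1)) :
    ∀ x ∈ G j, aeval T (∏ i with Fin.castSucc i < j, p i) x = 0 := by
  induction j using Fin.induction with
  | zero => simp [h0]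
  | succ j ih =>
    intro x hx
    have hs : (Finset.univ.filter fun i : Fin e => i.castSucc < j.succ) =
        insert j (Finset.univ.filter fun i : Fin e => i.castSucc < j.castSucc) := by
      ext i
      simp [Fin.castSucc_lt_succ_iff, le_iff_eq_or_lt]
    rw [hs, Finset.prod_insert (by simp), mul_comm, map_mul, Module.End.mul_apply]
    exact ih _ (hG j x hx)

theorem ker_le_of_chain (T : Module.End S F) (a : Fin e → S)
    (ha : ∀ i j : Fin e, i ≠ j → IsUnit (a i - a j))
    (G : Fin (e + 1) → Submodule S F) (htop : G (Fin.last e) = ⊤)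
    (hG : ∀ j : Fin e, ∀ x ∈ G j.succ, aeval T (X - C (a j)) x ∈ G j.castSucc)
    (i : Fin e) (j : Fin (e + 1)) :
    i.castSucc < j → LinearMap.ker (aeval T (X - C (a i))) ≤ G j := by
  induction j using Fin.reverseInduction with
  | last => simp [htop]
  | cast j ih =>
    intro hij x hx
    have hij' : i < j := by simpa using hij
    have hTx : T x = a i • x := by
      rwa [LinearMap.mem_ker, aeval_X_sub_C_apply, sub_eq_zero] at hx
    have h := hG j x (ih (hij.trans j.castSucc_lt_succ) hx)
    rw [aeval_X_sub_C_apply, hTx, ← sub_smul] at h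
    exact (Submodule.smul_mem_iff_of_isUnit (G j.castSucc) (ha i j hij'.ne)).mp h

/-- If the differences `a i - a j` are units and `∏ j, (T - a j) = 0`, then the chains
`0 = G 0 ≤ ⋯ ≤ G e = F` with `(T - a j) (G (j + 1)) ≤ G j` are exactly the partial sums of the
eigenspaces of `T`. -/
theorem chain_iff_eq_iSup_ker (T : Module.End S F) (a : Fin e → S)
    (ha : ∀ i j : Fin e, i ≠ j → IsUnit (a i - a j))
    (hT : aeval T (∏ j, (X - C (a j))) = 0) (G : Fin (e + 1) → Submodule S F) :
    (G 0 = ⊥ ∧ G (Fin.last e) = ⊤ ∧ (∀ j : Fin e, G j.castSucc ≤ G j.succ) ∧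
      ∀ j : Fin e, ∀ x ∈ G j.succ, aeval T (X - C (a j)) x ∈ G j.castSucc) ↔
    G = fun j : Fin (e + 1) => ⨆ i : Fin e, ⨆ _ : (i : ℕ) < (j : ℕ),
      LinearMap.ker (aeval T (X - C (a i))) := by
  have hp : Pairwise fun i j => IsCoprime (X - C (a i)) (X - C (a j)) := fun i j hij =>
    isCoprime_X_sub_C_of_isUnit_sub (ha i j hij)
  constructor
  · rintro ⟨h0, htop, -, hG⟩
    ext1 j
    apply le_antisymm
    · intro x hx
      have h := aeval_prod_apply_eq_zero_of_chain T _ G h0 hG j x hx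
      rw [← LinearMap.mem_ker, ker_aeval_prod_eq_iSup T _ hp] at h
      simpa [Fin.lt_def] using h
    · exact iSup₂_le fun i hij => ker_le_of_chain T a ha G htop hG i j hij
  · rintro rfl
    refine ⟨by simp, ?_, fun j => ?_, fun j => ?_⟩
    · have h := ker_aeval_prod_eq_iSup T _ hp Finset.univ
      rw [hT, LinearMap.ker_zero] at h
      simpa using h.symm
    · exact iSup₂_le fun i hij => le_iSup₂_of_le i (Nat.lt_succ_of_lt hij) le_rfl
    · suffices h : (⨆ i : Fin e, ⨆ _ : (i : ℕ) < (j.succ : ℕ),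
          LinearMap.ker (aeval T (X - C (a i)))) ≤
          (⨆ i : Fin e, ⨆ _ : (i : ℕ) < (j.castSucc : ℕ),
            LinearMap.ker (aeval T (X - C (a i)))).comap (aeval T (X - C (a j))) from
        fun x hx => h hx
      refine iSup₂_le fun i hij x hx => ?_
      rw [Submodule.mem_comap]
      rcases eq_or_ne i j with rfl | hne
      · rw [LinearMap.mem_ker.mp hx]
        exact zero_mem _
      · have hlt : (i : ℕ) < (j.castSucc : ℕ) :=
          lt_of_le_of_ne (Nat.lt_succ_iff.mp hij) (Fin.val_ne_of_ne hne)
        refine le_iSup₂_of_le (f := fun (i : Fin e) (_ : (i : ℕ) < (j.castSucc : ℕ)) =>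
          LinearMap.ker (aeval T (X - C (a i)))) i hlt le_rfl ?_
        rw [LinearMap.mem_ker, ← Module.End.mul_apply, ← map_mul, mul_comm, map_mul,
          Module.End.mul_apply, LinearMap.mem_ker.mp hx, map_zero]

end Module.End

/-- Let `S` be a commutative ring, `a 1, …, a e ∈ S` with `a i − a j` a
unit for `i ≠ j`, `A = S[X]/(∏ j, (X − a j))`, and `F` an `A`-module. Then `F` is the
internal direct sum of the submodules `K i = ker((X − a i)·)`, and there is exactly one
chain of `S`-submodules `0 = F^0 ⊆ F^1 ⊆ ⋯ ⊆ F^e = F` with `(X − a j)·F^j ⊆ F^{j−1}` for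
all `j`, namely `F^j = K 1 + ⋯ + K j`. -/
theorem internal_direct_sum_and_unique_splitting_filtration
    (S : Type*) [CommRing S] (e : ℕ) (he : 1 ≤ e) (a : Fin e → S)
    (ha : ∀ i j : Fin e, i ≠ j → IsUnit (a i - a j))
    (F : Type*) [AddCommGroup F]
    [Module (S[X] ⧸ Ideal.span {∏ j : Fin e, (X - C (a j))}) F]
    [Module S F]
    [IsScalarTower S (S[X] ⧸ Ideal.span {∏ j : Fin e, (X - C (a j))}) F] :
    DirectSum.IsInternal (fun i : Fin e =>
      LinearMap.ker ((LinearMap.lsmul (S[X] ⧸ Ideal.span {∏ j : Fin e, (X - C (a j))}) F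
        (Ideal.Quotient.mk (Ideal.span {∏ j : Fin e, (X - C (a j))})
          (X - C (a i)))).restrictScalars S)) ∧
    ∀ G : Fin (e + 1) → Submodule S F,
      (G 0 = ⊥ ∧ G (Fin.last e) = ⊤ ∧ (∀ j : Fin e, G j.castSucc ≤ G j.succ) ∧
        ∀ j : Fin e, ∀ x ∈ G j.succ,
          (Ideal.Quotient.mk (Ideal.span {∏ j : Fin e, (X - C (a j))})
            (X - C (a j))) • x ∈ G j.castSucc) ↔
      G = fun j : Fin (e + 1) => ⨆ i : Fin e, ⨆ _ : (i : ℕ) < (j : ℕ),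
        LinearMap.ker ((LinearMap.lsmul (S[X] ⧸ Ideal.span {∏ j : Fin e, (X - C (a j))}) F
          (Ideal.Quotient.mk (Ideal.span {∏ j : Fin e, (X - C (a j))})
            (X - C (a i)))).restrictScalars S) := by
  let I := Ideal.span {∏ j : Fin e, (X - C (a j))}
  let T : Module.End S F := Algebra.lsmul S S F (Ideal.Quotient.mk I X)
  have key (p : S[X]) : aeval T p = Algebra.lsmul S S F (Ideal.Quotient.mk I p) := by
    have h : aeval (Ideal.Quotient.mkₐ S I X) p = Ideal.Quotient.mkₐ S I p := by
      rw [aeval_algHom_apply, aeval_X_left_apply]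
    rw [← Ideal.Quotient.mkₐ_eq_mk S, ← h, ← aeval_algHom_apply]
    rfl
  have hker (i : Fin e) : LinearMap.ker ((LinearMap.lsmul (S[X] ⧸ I) F
      (Ideal.Quotient.mk I (X - C (a i)))).restrictScalars S) =
      LinearMap.ker (aeval T (X - C (a i))) := by
    rw [key]
    rfl
  have hT : aeval T (∏ j, (X - C (a j))) = 0 := by
    rw [key, Ideal.Quotient.eq_zero_iff_mem.mpr (Ideal.mem_span_singleton_self _), map_zero]
  have hp : Pairwise fun i j => IsCoprime (X - C (a i)) (X - C (a j)) := fun i j hij =>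
    isCoprime_X_sub_C_of_isUnit_sub (ha i j hij)
  have hsmul (j : Fin e) (x : F) :
      Ideal.Quotient.mk I (X - C (a j)) • x = aeval T (X - C (a j)) x := by
    rw [key]
    rfl
  simp only [I] at hker hsmul
  simp only [hker, hsmul]
  refine ⟨?_, Module.End.chain_iff_eq_iSup_ker T a ha hT⟩
  refine DirectSum.isInternal_submodule_of_iSupIndep_of_iSup_eq_top
    (iSupIndep_ker_aeval T _ hp) ?_
  have h := ker_aeval_prod_eq_iSup T _ hp Finset.univ
  rw [hT, LinearMap.ker_zero] at h
  simpa using h.symm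
end

section
/- Let R be a commutative ring, M an R-module, u : M → M an R-linear endomorphism, and F ⊆ u(M) a submodule such that both M/F and M/u(M) are projective R-modules. Then M/u⁻¹(F) is a projective R-module and the preimage u⁻¹(F) is a direct summand of M. -/
/-- A submodule with projective quotient is a direct summand. -/
theorem Submodule.exists_isCompl_of_projective_quotient {R M : Type*} [Ring R] [AddCommGroup M]
    [Module R M] (p : Submodule R M) [Module.Projective R (M ⧸ p)] :
    ∃ q : Submodule R M, IsCompl p q := by
  obtain ⟨s, hs⟩ := p.mkQ.exists_rightInverse_of_surjective p.range_mkQ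
  have hmk (x : M ⧸ p) : p.mkQ (s x) = x := LinearMap.congr_fun hs x
  have hmem (x : M) : ((LinearMap.id : M →ₗ[R] M) - s ∘ₗ p.mkQ) x ∈ p := by
    rw [← Submodule.Quotient.mk_eq_zero, ← Submodule.mkQ_apply]
    simp [-Submodule.mkQ_apply, hmk]
  exact ⟨_, LinearMap.isCompl_of_proj
    (f := ((LinearMap.id : M →ₗ[R] M) - s ∘ₗ p.mkQ).codRestrict p hmem)
    fun x ↦ by ext; simp [(Submodule.Quotient.mk_eq_zero p).mpr x.2]⟩

/-- The exact sequence `0 → M/u⁻¹(F) → M/F → M/u(M) → 0` for `F ≤ u(M)`, at its middle term. -/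
theorem Submodule.exact_mapQ_comap_factor {R M : Type*} [Ring R] [AddCommGroup M] [Module R M]
    (u : M →ₗ[R] M) {F : Submodule R M} (hF : F ≤ LinearMap.range u) :
    Function.Exact ((F.comap u).mapQ F u le_rfl) (Submodule.factor hF) := by
  rw [LinearMap.exact_iff]
  simp [Submodule.factor, Submodule.mapQ, Submodule.ker_liftQ, Submodule.range_liftQ,
    LinearMap.range_comp]

/-- Let `R` be a commutative ring, `M` an `R`-module, `u : M → M` linear,
and `F ⊆ u(M)` a submodule such that `M/F` and `M/u(M)` are projective. Then `M/u⁻¹(F)` is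
projective and `u⁻¹(F)` is a direct summand of `M`. -/
theorem preimage_is_direct_summand (R : Type*) [CommRing R]
    (M : Type*) [AddCommGroup M] [Module R M] (u : M →ₗ[R] M)
    (F : Submodule R M) (hF : F ≤ LinearMap.range u)
    (h1 : Module.Projective R (M ⧸ F))
    (h2 : Module.Projective R (M ⧸ LinearMap.range u)) :
    Module.Projective R (M ⧸ Submodule.comap u F) ∧
      ∃ C : Submodule R M, IsCompl (Submodule.comap u F) C := by
  have hinj : Function.Injective ((F.comap u).mapQ F u le_rfl) := by
    rw [← LinearMap.ker_eq_bot]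
    simp [Submodule.mapQ, Submodule.ker_liftQ, LinearMap.ker_comp]
  have hsplit := (Submodule.factor hF).exists_rightInverse_of_surjective
    (LinearMap.range_eq_top.mpr (Submodule.factor_surjective hF))
  have htfae := (Submodule.exact_mapQ_comap_factor u hF).split_tfae'
  obtain ⟨-, l, hl⟩ := (htfae.out 0 1 rfl rfl).mp ⟨hinj, hsplit⟩
  have hproj : Module.Projective R (M ⧸ Submodule.comap u F) := .of_split _ l hl
  exact ⟨hproj, Submodule.exists_isCompl_of_projective_quotient _⟩
end

section
/- Let S be a commutative local ring, let M and N be finite free S-modules, and let B : M × N → S be an S-bilinear form such that the induced maps M → Hom_S(N, S) and N → Hom_S(M, S) are bijective. Let F ⊆ M and G ⊆ N be direct summands with rank F + rank G = rank M, and suppose B(v, w) = 0 for all v ∈ F and w ∈ G. Then G = {w ∈ N : B(v, w) = 0 for all v ∈ F} and F = {v ∈ M : B(v, w) = 0 for all w ∈ G}. -/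
/-- A direct summand of a finite free module over a local ring is finite free. -/
theorem Submodule.finite_and_free_of_isCompl {S M : Type*} [CommRing S] [IsLocalRing S]
    [AddCommGroup M] [Module S M] [Module.Free S M] [Module.Finite S M]
    {F C : Submodule S M} (h : IsCompl F C) : Module.Finite S F ∧ Module.Free S F := by
  have hfin : Module.Finite S F :=
    Module.Finite.of_surjective (F.projectionOnto C h)
      fun x ↦ ⟨x, Submodule.projectionOnto_apply_left h x⟩
  have hproj : Module.Projective S F :=
    Module.Projective.of_split F.subtype (F.projectionOnto C h)
      (LinearMap.ext fun x ↦ Submodule.projectionOnto_apply_left h x)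
  exact ⟨hfin, Module.free_of_flat_of_isLocalRing⟩

/-- If every functional on `M` is represented by `B`, and `F`, `G` are mutually orthogonal direct
summands with `rank F + rank G = rank N`, then every vector orthogonal to `F` lies in `G`. -/
theorem Submodule.mem_of_orthogonal_of_finrank_add_finrank {S M N : Type*}
    [CommRing S] [IsLocalRing S]
    [AddCommGroup M] [Module S M] [Module.Free S M] [Module.Finite S M]
    [AddCommGroup N] [Module S N] [Module.Free S N] [Module.Finite S N]
    (B : M →ₗ[S] N →ₗ[S] S) (hB : Function.Surjective B.flip)
    {F C : Submodule S M} {G D : Submodule S N} (hF : IsCompl F C) (hG : IsCompl G D)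
    (hrank : Module.finrank S F + Module.finrank S G = Module.finrank S N)
    (hiso : ∀ v ∈ F, ∀ w ∈ G, B v w = 0) {w : N} (hw : ∀ v ∈ F, B v w = 0) : w ∈ G := by
  obtain ⟨_, _⟩ := finite_and_free_of_isCompl hF
  obtain ⟨_, _⟩ := finite_and_free_of_isCompl hG
  obtain ⟨_, _⟩ := finite_and_free_of_isCompl hG.symm
  have hD : Module.finrank S D = Module.finrank S (F →ₗ[S] S) := by
    have hN := (G.prodEquivOfIsCompl D hG).finrank_eq
    rw [Module.finrank_prod] at hN
    rw [Module.finrank_linearMap_self]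
    omega
  have split (x : N) : ∃ g ∈ G, ∃ d ∈ D, g + d = x :=
    Submodule.mem_sup.mp (hG.sup_eq_top ▸ Submodule.mem_top)
  let φ : D →ₗ[S] F →ₗ[S] S := (B.domRestrict F).flip.domRestrict D
  have hφ : Function.Surjective φ := by
    intro f
    obtain ⟨x, hx⟩ := hB (f ∘ₗ F.projectionOnto C hF)
    obtain ⟨g, hg, d, hd, rfl⟩ := split x
    refine ⟨⟨d, hd⟩, LinearMap.ext fun v ↦ ?_⟩
    have hv := LinearMap.congr_fun hx v
    simpa [φ, hiso v v.2 g hg] using hv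
  have hinj := (OrzechProperty.bijective_of_surjective_of_finrank_le φ hφ hD.le).injective
  obtain ⟨g, hg, d, hd, rfl⟩ := split w
  have hd0 : (⟨d, hd⟩ : D) = 0 := by
    apply hinj
    ext v
    simpa [φ, hiso v v.2 g hg] using hw v v.2
  rw [Submodule.mk_eq_zero] at hd0
  simpa [hd0] using hg

/-- Let `S` be a commutative local ring, `M, N` finite free `S`-modules,
and `B : M × N → S` a perfect `S`-bilinear form. If `F ⊆ M` and `G ⊆ N` are direct
summands with `rank F + rank G = rank M` and `B(F, G) = 0`, then `G` is the orthogonal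
complement of `F` and `F` is the orthogonal complement of `G`. -/
theorem orthogonal_complements_of_isotropic_summands
    (S : Type*) [CommRing S] [IsLocalRing S]
    (M : Type*) [AddCommGroup M] [Module S M] [Module.Free S M] [Module.Finite S M]
    (N : Type*) [AddCommGroup N] [Module S N] [Module.Free S N] [Module.Finite S N]
    (B : M →ₗ[S] N →ₗ[S] S)
    (hperf₁ : Function.Bijective B) (hperf₂ : Function.Bijective B.flip)
    (F : Submodule S M) (G : Submodule S N)
    (hFsum : ∃ C : Submodule S M, IsCompl F C)
    (hGsum : ∃ C : Submodule S N, IsCompl G C)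
    (hrank : Module.finrank S F + Module.finrank S G = Module.finrank S M)
    (hiso : ∀ v ∈ F, ∀ w ∈ G, B v w = 0) :
    (G : Set N) = {w : N | ∀ v ∈ F, B v w = 0} ∧
    (F : Set M) = {v : M | ∀ w ∈ G, B v w = 0} := by
  obtain ⟨C, hC⟩ := hFsum
  obtain ⟨D, hD⟩ := hGsum
  have hMN : Module.finrank S M = Module.finrank S N := by
    rw [(LinearEquiv.ofBijective B hperf₁).finrank_eq, Module.finrank_linearMap_self]
  refine ⟨Set.ext fun w ↦ ⟨fun hw v hv ↦ hiso v hv w hw, fun hw ↦ ?_⟩,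
    Set.ext fun v ↦ ⟨fun hv w hw ↦ hiso v hv w hw, fun hv ↦ ?_⟩⟩
  · exact Submodule.mem_of_orthogonal_of_finrank_add_finrank B hperf₂.surjective hC hD
      (hrank.trans hMN) hiso hw
  · exact Submodule.mem_of_orthogonal_of_finrank_add_finrank B.flip hperf₁.surjective hD hC
      ((add_comm _ _).trans hrank) (fun w hw v hv ↦ hiso v hv w hw) hv
end
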